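/- Let G be a finite connected simple graph that is 3-regular and whose algebraic connectivity satisfies λ₂(G) ≥ 3 − 2√2. Then gon(G) ≥ 0.0486·|V(G)|. -/

import Mathlib

open SimpleGraph Finset

namespace GraphGonality

variable {V : Type*}

/-- The degree of a divisor: the sum of its values. -/
def degD [Fintype V] (D : V → ℤ) : ℤ := ∑ v, D v

/-- A divisor is effective if it is nonnegative at every vertex. -/
def Effective (D : V → ℤ) : Prop := ∀ v, 0 ≤ D v

/-- The graph Laplacian applied to an integer vector. -/
def lapply (G : SimpleGraph V) [Fintype V] [DecidableEq V] [DecidableRel G.Adj]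
    (x : V → ℤ) : V → ℤ :=
  fun v => (G.degree v : ℤ) * x v - ∑ w ∈ G.neighborFinset v, x w

/-- Two divisors are linearly equivalent if their difference lies in the image of the
Laplacian acting on `ℤ^V`. -/
def LinEquiv (G : SimpleGraph V) [Fintype V] [DecidableEq V] [DecidableRel G.Adj]
    (D D' : V → ℤ) : Prop :=
  ∃ x : V → ℤ, D - D' = lapply G x

/-- A divisor has positive rank if, for every vertex `v`, the divisor `D - 1_v` is
linearly equivalent to an effective divisor. -/
def PosRank (G : SimpleGraph V) [Fintype V] [DecidableEq V] [DecidableRel G.Adj]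
    (D : V → ℤ) : Prop :=
  ∀ v : V, ∃ E : V → ℤ, Effective E ∧
    LinEquiv G (fun w => D w - if w = v then 1 else 0) E

/-- The gonality of a graph: the smallest degree of a divisor of positive rank. -/
noncomputable def gonality (G : SimpleGraph V) [Fintype V] [DecidableEq V]
    [DecidableRel G.Adj] : ℤ :=
  sInf {d : ℤ | ∃ D : V → ℤ, PosRank G D ∧ degD D = d}

/-- The support of a divisor. -/
def suppD (D : V → ℤ) : Set V := {v | 0 < D v}

/-- The edge boundary of a set of vertices: edges with exactly one endpoint in `U`. -/
def edgeBoundary (G : SimpleGraph V) (U : Set V) : Set (Sym2 V) :=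
  {e | e ∈ G.edgeSet ∧ ∃ a b, e = s(a, b) ∧ a ∈ U ∧ b ∉ U}

/-- The Cheeger constant of a graph. -/
noncomputable def cheeger (G : SimpleGraph V) [Fintype V] : ℝ :=
  sInf {r : ℝ | ∃ U : Set V, U.Nonempty ∧ (U.ncard : ℝ) ≤ (Fintype.card V : ℝ) / 2 ∧
    r = (edgeBoundary G U).ncard / U.ncard}

/-- The `u`-Cheeger constant of a graph. -/
noncomputable def cheegerU (G : SimpleGraph V) [Fintype V] (u : ℝ) : ℝ :=
  sInf {r : ℝ | ∃ U : Set V, U.Nonempty ∧ (U.ncard : ℝ) ≤ u * (Fintype.card V : ℝ) ∧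
    r = (edgeBoundary G U).ncard / U.ncard}

/-- Every connected component of the induced subgraph on the complement of the support
of `D` has at most `u * |V|` vertices. -/
def ComponentsSmall (G : SimpleGraph V) [Fintype V] (D : V → ℤ) (u : ℝ) : Prop :=
  ∀ c : (G.induce (suppD D)ᶜ).ConnectedComponent,
    (c.supp.ncard : ℝ) ≤ u * (Fintype.card V : ℝ)

/-- `B_u(G)`: the smallest degree of an effective divisor all of whose complementary
components have size at most `u * |V|`. -/
noncomputable def Bu (G : SimpleGraph V) [Fintype V] (u : ℝ) : ℤ :=
  sInf {d : ℤ | ∃ D : V → ℤ, Effective D ∧ ComponentsSmall G D u ∧ degD D = d}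


/-- The algebraic connectivity: the second smallest eigenvalue (with multiplicity)
of the graph Laplacian. -/
noncomputable def algConn (G : SimpleGraph V) [Fintype V] [DecidableEq V]
    [DecidableRel G.Adj] : ℝ :=
  (((Finset.univ.val.map
      (SimpleGraph.posSemidef_lapMatrix ℝ G).isHermitian.eigenvalues)).sort (· ≤ ·)).getD 1 0

theorem lapply_eq_sum_sub (G : SimpleGraph V) [Fintype V] [DecidableEq V] [DecidableRel G.Adj]
    (x : V → ℤ) (v : V) : lapply G x v = ∑ w ∈ G.neighborFinset v, (x v - x w) := by
  simp [lapply, Finset.sum_sub_distrib]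

theorem lapply_sub (G : SimpleGraph V) [Fintype V] [DecidableEq V] [DecidableRel G.Adj]
    (x y : V → ℤ) : lapply G (x - y) = lapply G x - lapply G y := by
  funext v
  simp only [lapply_eq_sum_sub, Pi.sub_apply, ← Finset.sum_sub_distrib]
  exact Finset.sum_congr rfl fun w _ => by ring

theorem degD_lapply (G : SimpleGraph V) [Fintype V] [DecidableEq V] [DecidableRel G.Adj]
    (x : V → ℤ) : degD (lapply G x) = 0 := by
  have h : ∑ v, ∑ w ∈ G.neighborFinset v, x w = ∑ v, ∑ w ∈ G.neighborFinset v, x v := by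
    rw [Finset.sum_comm' (t' := Finset.univ) (s' := fun w => G.neighborFinset w)]
    simp [G.adj_comm]
  simp only [degD, lapply_eq_sum_sub, Finset.sum_sub_distrib]
  rw [h, sub_self]

theorem LinEquiv.degD_eq {G : SimpleGraph V} [Fintype V] [DecidableEq V] [DecidableRel G.Adj]
    {D E : V → ℤ} (h : LinEquiv G D E) : degD D = degD E := by
  obtain ⟨x, hx⟩ := h
  have h0 := degD_lapply G x
  rw [← hx] at h0
  simp only [degD, Pi.sub_apply, Finset.sum_sub_distrib] at h0 ⊢
  omega

theorem PosRank.exists_effective_pos {G : SimpleGraph V} [Fintype V] [DecidableEq V]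
    [DecidableRel G.Adj] {D : V → ℤ} (hD : PosRank G D) (q : V) :
    ∃ E : V → ℤ, Effective E ∧ LinEquiv G D E ∧ 0 < E q := by
  obtain ⟨E, hE, x, hx⟩ := hD q
  refine ⟨fun w => E w + if w = q then 1 else 0, fun w => ?_, ⟨x, ?_⟩, ?_⟩
  · have := hE w
    dsimp only
    split_ifs <;> omega
  · rw [← hx]
    funext w
    simp only [Pi.sub_apply]
    ring
  · have := hE q
    simp only [if_true]
    omega

/-- A set of vertices is linked if it cannot be split into two nonempty parts with no edge
between them. -/
def Linked (G : SimpleGraph V) (B : Finset V) : Prop :=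
  ∀ U : Set V, (∃ u ∈ B, u ∈ U) → (∃ w ∈ B, w ∉ U) →
    ∃ u ∈ B, ∃ w ∈ B, u ∈ U ∧ w ∉ U ∧ G.Adj u w

/-- If firing `U` brings the first chip to a linked set, then that set is disjoint from `U`. -/
theorem Linked.notMem_of_fire {G : SimpleGraph V} [Fintype V] [DecidableEq V]
    [DecidableRel G.Adj] {B : Finset V} (hB : Linked G B) {E E' z : V → ℤ} {U : Set V} {c : ℤ}
    (hE' : Effective E') (hfire : E - E' = lapply G z)
    (hmem : ∀ v ∈ U, z v = c + 1) (hnot : ∀ v ∉ U, z v = c)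
    (hmiss : ∀ b ∈ B, E b = 0) (hhit : ∃ b ∈ B, 0 < E' b) : ∀ b ∈ B, b ∉ U := by
  have hle : ∀ v, z v ≤ c + 1 := fun v => by
    by_cases hv : v ∈ U
    · rw [hmem v hv]
    · rw [hnot v hv]; omega
  have hnonneg : ∀ u ∈ U, ∀ w, 0 ≤ z u - z w := fun u hu w => by
    rw [hmem u hu]
    have := hle w
    omega
  have hf : ∀ v, E v - E' v = ∑ w ∈ G.neighborFinset v, (z v - z w) := fun v => by
    rw [← lapply_eq_sum_sub, ← hfire, Pi.sub_apply]
  obtain ⟨b, hbB, hb⟩ := hhit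
  have hbU : b ∉ U := fun hbU => by
    have h1 := Finset.sum_nonneg fun w (_ : w ∈ G.neighborFinset b) => hnonneg b hbU w
    have h2 := hf b
    have h3 := hmiss b hbB
    omega
  intro a haB haU
  obtain ⟨u, huB, w, -, huU, hwU, hadj⟩ := hB U ⟨a, haB, haU⟩ ⟨b, hbB, hbU⟩
  have h1 := Finset.single_le_sum (fun w (_ : w ∈ G.neighborFinset u) => hnonneg u huU w)
    ((G.mem_neighborFinset u w).2 hadj)
  rw [← hf u, hmem u huU, hnot w hwU, hmiss u huB] at h1
  have := hE' u
  omega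

/-- Truncating a firing script from below keeps the resulting divisor effective. -/
theorem effective_sub_lapply_max {G : SimpleGraph V} [Fintype V] [DecidableEq V]
    [DecidableRel G.Adj] {E E' x : V → ℤ} (hE : Effective E) (hE' : Effective E')
    (hx : E - E' = lapply G x) (t : ℤ) :
    Effective (E - lapply G fun v => max (x v) t) := by
  intro v
  have h0 : E v - E' v = ∑ w ∈ G.neighborFinset v, (x v - x w) := by
    rw [← lapply_eq_sum_sub, ← hx, Pi.sub_apply]
  have h1 := hE v
  have h2 := hE' v
  rw [Pi.sub_apply, lapply_eq_sum_sub]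
  rcases le_total t (x v) with h | h
  · have : ∑ w ∈ G.neighborFinset v, (max (x v) t - max (x w) t) ≤
        ∑ w ∈ G.neighborFinset v, (x v - x w) :=
      Finset.sum_le_sum fun w _ => by
        rw [max_eq_left h]
        have := le_max_left (x w) t
        omega
    omega
  · have : ∑ w ∈ G.neighborFinset v, (max (x v) t - max (x w) t) ≤ 0 :=
      Finset.sum_nonpos fun w _ => by
        rw [max_eq_right h]
        have := le_max_right (x w) t
        omega
    omega

theorem exists_lt_and_not_succ {p : ℕ → Prop} {k : ℕ} (h0 : p 0) (hk : ¬ p k) :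
    ∃ j < k, p j ∧ ¬ p (j + 1) := by
  by_contra! h
  exact hk (Nat.le_induction (m := 0) (P := fun n _ => n ≤ k → p n) (fun _ => h0)
    (fun n _ ih hn => h n hn (ih (by omega))) k (Nat.zero_le k) le_rfl)

/-- Some effective divisor hits `B` and every linked set meeting `B` that `E` hits. -/
theorem exists_effective_hitting {G : SimpleGraph V} [Fintype V] [DecidableEq V]
    [DecidableRel G.Adj] {E E' : V → ℤ} (hE : Effective E) (hE' : Effective E')
    (hEE : LinEquiv G E E') {B : Finset V} (hB : Linked G B) (hmiss : ∀ b ∈ B, E b = 0)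
    (hhit : ∃ b ∈ B, 0 < E' b) :
    ∃ F : V → ℤ, Effective F ∧ LinEquiv G E F ∧ (∃ b ∈ B, 0 < F b) ∧
      ∀ B' : Finset V, Linked G B' → (∃ v ∈ B, v ∈ B') → (∃ b ∈ B', 0 < E b) →
        ∃ b ∈ B', 0 < F b := by
  obtain ⟨x, hx⟩ := hEE
  have hbound : ∀ v, |x v| ≤ ∑ w, |x w| := fun v =>
    Finset.single_le_sum (fun w _ => abs_nonneg (x w)) (Finset.mem_univ v)
  set N := ∑ w, |x w| with hN
  have hN0 : 0 ≤ N := Finset.sum_nonneg fun w _ => abs_nonneg _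
  let F : ℕ → V → ℤ := fun k => E - lapply G fun v => max (x v) (N - k)
  have hF : ∀ k, Effective (F k) := fun k => effective_sub_lapply_max hE hE' hx _
  have hF0 : F 0 = E := by
    funext v
    have : ∀ w, max (x w) (N - (0 : ℕ)) = N := fun w =>
      by have := (abs_le.1 (hbound w)).2; simpa using this
    simp only [F, Pi.sub_apply, lapply_eq_sum_sub, this]
    simp
  have hFlast : F (2 * N).toNat = E' := by
    have : (fun v => max (x v) (N - ((2 * N).toNat : ℤ))) = x := by
      funext v
      have := (abs_le.1 (hbound v)).1
      rw [max_eq_left]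
      omega
    simp only [F, this, ← hx, sub_sub_cancel]
  have hzero : ∀ {k : ℕ} {A : Finset V}, (¬ ∃ b ∈ A, 0 < F k b) → ∀ b ∈ A, F k b = 0 := by
    intro k A h b hb
    have h1 := hF k b
    have h2 : ¬ 0 < F k b := fun h3 => h ⟨b, hb, h3⟩
    omega
  have hstep : ∀ k : ℕ, F k - F (k + 1) =
      lapply G ((fun v => max (x v) (N - (k + 1 : ℕ))) - fun v => max (x v) (N - k)) := by
    intro k
    rw [lapply_sub]
    simp only [F]
    abel
  have hstep' : ∀ k : ℕ, F (k + 1) - F k =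
      lapply G ((fun v => max (x v) (N - k)) - fun v => max (x v) (N - (k + 1 : ℕ))) := by
    intro k
    rw [lapply_sub]
    simp only [F]
    abel
  obtain ⟨i, -, hi, hi'⟩ := exists_lt_and_not_succ (p := fun k => ¬ ∃ b ∈ B, 0 < F k b)
    (k := (2 * N).toNat)
    (by rw [hF0]; rintro ⟨b, hb, h⟩; rw [hmiss b hb] at h; exact lt_irrefl _ h)
    (by rw [hFlast]; exact not_not.2 hhit)
  rw [not_not] at hi'
  refine ⟨F (i + 1), hF _, ⟨_, sub_sub_cancel _ _⟩, hi', fun B' hB' hBB' hEB' => ?_⟩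
  by_contra hcon
  obtain ⟨j, hji, hj, hj'⟩ := exists_lt_and_not_succ (p := fun k => ∃ b ∈ B', 0 < F k b)
    (k := i + 1) (by rw [hF0]; exact hEB') hcon
  obtain ⟨v, hvB, hvB'⟩ := hBB'
  have h1 := hB.notMem_of_fire (U := {v | N - i ≤ x v}) (c := -1) (hF _) (hstep i)
    (fun v hv => by
      simp only [Set.mem_ofPred_eq] at hv
      simp only [Pi.sub_apply]; push_cast
      omega)
    (fun v hv => by
      simp only [Set.mem_ofPred_eq] at hv
      simp only [Pi.sub_apply]; push_cast
      omega) (hzero hi) hi' v hvB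
  have h2 := hB'.notMem_of_fire (U := {v | x v < N - j}) (c := 0) (hF _) (hstep' j)
    (fun v hv => by
      simp only [Set.mem_ofPred_eq] at hv
      simp only [Pi.sub_apply]; push_cast
      omega)
    (fun v hv => by
      simp only [Set.mem_ofPred_eq] at hv
      simp only [Pi.sub_apply]; push_cast
      omega) (hzero hj') hj v hvB'
  simp only [Set.mem_ofPred_eq] at h1 h2
  omega

/-- A divisor of positive rank is equivalent to an effective divisor whose support meets every
linked set containing more than half of the vertices. -/
theorem PosRank.exists_hitting {G : SimpleGraph V} [Fintype V] [DecidableEq V]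
    [DecidableRel G.Adj] [Nonempty V] {D : V → ℤ} (hD : PosRank G D) :
    ∃ E : V → ℤ, Effective E ∧ LinEquiv G D E ∧
      ∀ B : Finset V, Linked G B → Fintype.card V < 2 * B.card → ∃ b ∈ B, 0 < E b := by
  classical
  let H : (V → ℤ) → Finset (Finset V) := fun E => Finset.univ.filter fun B =>
    Linked G B ∧ Fintype.card V < 2 * B.card ∧ ∃ b ∈ B, 0 < E b
  by_contra! hcon
  have key : ∀ k : ℕ, ∃ E : V → ℤ, Effective E ∧ LinEquiv G D E ∧ k ≤ (H E).card := by
    intro k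
    induction k with
    | zero =>
      obtain ⟨E, hE, hDE, -⟩ := hD.exists_effective_pos (Classical.arbitrary V)
      exact ⟨E, hE, hDE, Nat.zero_le _⟩
    | succ k ih =>
      obtain ⟨E, hE, ⟨x, hx⟩, hk⟩ := ih
      obtain ⟨B, hB, hcard, hmiss⟩ := hcon E hE ⟨x, hx⟩
      obtain ⟨q, hq⟩ : B.Nonempty := Finset.card_pos.1 (by omega)
      obtain ⟨E', hE', ⟨y, hy⟩, hpos⟩ := hD.exists_effective_pos q
      obtain ⟨F, hF, ⟨z, hz⟩, hFB, hFB'⟩ := exists_effective_hitting hE hE'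
        ⟨y - x, by rw [lapply_sub, ← hx, ← hy]; abel⟩ hB
        (fun b hb => le_antisymm (hmiss b hb) (hE b)) ⟨q, hq, hpos⟩
      refine ⟨F, hF, ⟨x - (-z), ?_⟩, hk.trans_lt (Finset.card_lt_card ?_)⟩
      · have : lapply G (-z) = - lapply G z := by
          rw [← zero_sub z, lapply_sub]
          funext v
          simp [lapply]
        rw [lapply_sub, this, ← hx, ← hz]
        abel
      · rw [Finset.ssubset_iff_of_subset]
        · refine ⟨B, by simp [H, hB, hcard, hFB], fun h => ?_⟩
          obtain ⟨-, -, -, b, hb, hb'⟩ := Finset.mem_filter.1 h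
          exact absurd (hmiss b hb) (not_le.2 hb')
        · intro B' h
          obtain ⟨-, hB', hcard', hE_hit⟩ := Finset.mem_filter.1 h
          refine Finset.mem_filter.2 ⟨Finset.mem_univ _, hB', hcard', hFB' B' hB' ?_ hE_hit⟩
          by_contra! hdisj
          have h1 := Finset.card_union_of_disjoint (Finset.disjoint_left.2 hdisj)
          have h2 := Finset.card_le_univ (B ∪ B')
          omega
  obtain ⟨E, -, -, h⟩ := key ((Finset.univ : Finset (Finset V)).card + 1)
  have := Finset.card_le_univ (H E)
  rw [← Finset.card_univ] at this
  omega

/-- If a vertex set `S` meets every large linked set, its complement splits into two parts with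
no edge between them, each containing at least a third of the complement. -/
theorem exists_balanced_split (G : SimpleGraph V) [Fintype V] [DecidableEq V] {S : Finset V}
    (hS : ∀ B : Finset V, Linked G B → Fintype.card V < 2 * B.card → ∃ b ∈ B, b ∈ S)
    (hcard : 4 * S.card < Fintype.card V) :
    ∃ A ⊆ Sᶜ, (∀ u ∈ A, ∀ w ∉ A, G.Adj u w → w ∈ S) ∧
      Sᶜ.card ≤ 3 * A.card ∧ 3 * A.card ≤ 2 * Sᶜ.card := by
  classical
  have hcompl := Finset.card_add_card_compl S
  obtain ⟨A, hA, hmin⟩ := Finset.exists_min_image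
    (Finset.univ.filter fun A : Finset V => A ⊆ Sᶜ ∧
      (∀ u ∈ A, ∀ w ∉ A, G.Adj u w → w ∈ S) ∧ 2 * Sᶜ.card < 3 * A.card) Finset.card
    ⟨Sᶜ, Finset.mem_filter.2 ⟨Finset.mem_univ _, subset_rfl,
      fun u _ w hw _ => by simpa using hw, by omega⟩⟩
  obtain ⟨-, hAS, hclosed, hlarge⟩ := Finset.mem_filter.1 hA
  have hnot : ¬ Linked G A := fun h => by
    obtain ⟨b, hb, hbS⟩ := hS A h (by omega)
    exact Finset.mem_compl.1 (hAS hb) hbS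
  unfold Linked at hnot
  push Not at hnot
  obtain ⟨U, ⟨a, ha, haU⟩, ⟨b, hb, hbU⟩, hU⟩ := hnot
  have hsplit := Finset.card_filter_add_card_filter_not (s := A) (fun v => v ∈ U)
  have hsmall : ∀ A' ⊆ A, (∀ u ∈ A', ∀ w ∉ A', G.Adj u w → w ∈ S) → A'.card < A.card →
      3 * A'.card ≤ 2 * Sᶜ.card := by
    intro A' hsub hcl hlt
    by_contra! hbig
    have := hmin A' (Finset.mem_filter.2 ⟨Finset.mem_univ _, hsub.trans hAS, hcl, hbig⟩)
    omega
  have hcl1 : ∀ u ∈ A.filter (· ∈ U), ∀ w ∉ A.filter (· ∈ U), G.Adj u w → w ∈ S := by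
    intro u hu w hw hadj
    rw [Finset.mem_filter] at hu hw
    by_cases hwA : w ∈ A
    · exact absurd hadj (hU u hu.1 w hwA hu.2 fun h => hw ⟨hwA, h⟩)
    · exact hclosed u hu.1 w hwA hadj
  have hcl2 : ∀ u ∈ A.filter (· ∉ U), ∀ w ∉ A.filter (· ∉ U), G.Adj u w → w ∈ S := by
    intro u hu w hw hadj
    rw [Finset.mem_filter] at hu hw
    by_cases hwA : w ∈ A
    · exact absurd hadj.symm (hU w hwA u hu.1 (by_contra fun h => hw ⟨hwA, h⟩) hu.2)
    · exact hclosed u hu.1 w hwA hadj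
  have hpos1 : 0 < (A.filter (· ∈ U)).card :=
    Finset.card_pos.2 ⟨a, Finset.mem_filter.2 ⟨ha, haU⟩⟩
  have hpos2 : 0 < (A.filter (· ∉ U)).card :=
    Finset.card_pos.2 ⟨b, Finset.mem_filter.2 ⟨hb, hbU⟩⟩
  have h1 := hsmall _ (Finset.filter_subset _ _) hcl1 (by omega)
  have h2 := hsmall _ (Finset.filter_subset _ _) hcl2 (by omega)
  rcases le_total (A.filter (· ∈ U)).card (A.filter (· ∉ U)).card with h | h
  · exact ⟨_, (Finset.filter_subset _ _).trans hAS, hcl2, by omega, h2⟩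
  · exact ⟨_, (Finset.filter_subset _ _).trans hAS, hcl1, by omega, h1⟩

/-- All entries of a finite family but one are at least the second smallest entry. -/
theorem exists_forall_ne_sort_getD_one_le {ι : Type*} [Fintype ι] [DecidableEq ι] (e : ι → ℝ)
    (h : 0 < ((Finset.univ.val.map e).sort (· ≤ ·)).getD 1 0) :
    ∃ i₀, ∀ i ≠ i₀, ((Finset.univ.val.map e).sort (· ≤ ·)).getD 1 0 ≤ e i := by
  have hcoe := Multiset.sort_eq (Finset.univ.val.map e) (· ≤ ·)
  have hsorted := Multiset.pairwise_sort (Finset.univ.val.map e) (· ≤ ·)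
  rcases hl : (Finset.univ.val.map e).sort (· ≤ ·) with _ | ⟨a, _ | ⟨b, l⟩⟩
  · simp [hl] at h
  · simp [hl] at h
  · rw [hl] at hcoe hsorted
    have ha : a ∈ Finset.univ.val.map e := by rw [← hcoe]; simp
    obtain ⟨i₀, -, rfl⟩ := Multiset.mem_map.1 ha
    refine ⟨i₀, fun i hi => ?_⟩
    have herase : Finset.univ.val = i₀ ::ₘ (Finset.univ.erase i₀).val := by
      rw [Finset.erase_val, Multiset.cons_erase (Finset.mem_univ i₀)]
    rw [herase, Multiset.map_cons, ← Multiset.cons_coe, Multiset.cons_inj_right] at hcoe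
    have hmem : e i ∈ ((b :: l : List ℝ) : Multiset ℝ) := by
      rw [hcoe]
      exact Multiset.mem_map_of_mem e (Finset.mem_erase.2 ⟨hi, Finset.mem_univ i⟩)
    rw [Multiset.mem_coe, List.mem_cons] at hmem
    simp only [List.getD_cons_succ, List.getD_cons_zero]
    rcases hmem with hmem | hmem
    · exact hmem.ge
    · exact (List.pairwise_cons.1 (List.pairwise_cons.1 hsorted).2).1 _ hmem

open Matrix in
/-- The variational bound for the algebraic connectivity. -/
theorem algConn_mul_le (G : SimpleGraph V) [Fintype V] [DecidableEq V] [DecidableRel G.Adj]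
    (hpos : 0 < algConn G) (f : V → ℝ) (hf : ∑ v, f v = 0) :
    algConn G * ∑ v, f v ^ 2 ≤ (∑ i, ∑ j, if G.Adj i j then (f i - f j) ^ 2 else 0) / 2 := by
  classical
  set hL := (SimpleGraph.posSemidef_lapMatrix ℝ G).isHermitian with hLdef
  obtain ⟨i₀, hi₀⟩ := exists_forall_ne_sort_getD_one_le hL.eigenvalues hpos
  change ∀ i ≠ i₀, algConn G ≤ hL.eigenvalues i at hi₀
  let c : (V → ℝ) → V → ℝ := fun g i => (hL.eigenvectorBasis i).ofLp ⬝ᵥ g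
  have hparseval : ∀ g g' : V → ℝ, ∑ i, c g i * c g' i = g ⬝ᵥ g' := by
    intro g g'
    have := hL.eigenvectorBasis.sum_inner_mul_inner (WithLp.toLp 2 g) (WithLp.toLp 2 g')
    simp only [EuclideanSpace.inner_eq_star_dotProduct, star_trivial] at this
    rw [dotProduct_comm g g', ← this]
    refine Finset.sum_congr rfl fun i _ => ?_
    simp only [c]
    rw [dotProduct_comm _ g']
  have heig : ∀ g i, c (G.lapMatrix ℝ *ᵥ g) i = hL.eigenvalues i * c g i := by
    intro g i
    simp only [c]
    rw [dotProduct_mulVec, ← mulVec_transpose, (G.isSymm_lapMatrix (R := ℝ)).eq,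
      hL.mulVec_eigenvectorBasis, smul_dotProduct, smul_eq_mul]
  have hone : ∀ i ≠ i₀, c (fun _ => 1) i = 0 := by
    intro i hi
    have h := heig (fun _ => 1) i
    have h0 : G.lapMatrix ℝ *ᵥ (fun _ => (1 : ℝ)) = 0 := G.lapMatrix_mulVec_const_eq_zero
    rw [h0] at h
    have hc0 : c 0 i = 0 := by simp [c]
    rw [hc0] at h
    exact (mul_eq_zero.1 h.symm).resolve_left (hpos.trans_le (hi₀ i hi)).ne'
  have hfi₀ : c f i₀ = 0 := by
    have h1 := hparseval f fun _ => 1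
    have h2 := hparseval (fun _ => 1) fun _ => 1
    rw [Finset.sum_eq_single i₀ (fun i _ hi => by rw [hone i hi, mul_zero]) (by simp)] at h1 h2
    have h3 : f ⬝ᵥ (fun _ => (1 : ℝ)) = 0 := by simpa [dotProduct] using hf
    have h4 : (fun _ : V => (1 : ℝ)) ⬝ᵥ (fun _ => 1) ≠ 0 := by
      have : Nonempty V := ⟨i₀⟩
      simp [dotProduct]
    rw [h3] at h1
    rw [← h2] at h4
    exact (mul_eq_zero.1 h1).resolve_right (left_ne_zero_of_mul h4)
  have hquad := G.lapMatrix_toLinearMap₂' ℝ f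
  rw [Matrix.toLinearMap₂'_apply', ← hparseval] at hquad
  have hnorm : ∑ v, f v ^ 2 = ∑ i, c f i * c f i := by
    rw [hparseval]
    simp [dotProduct, sq]
  rw [← hquad, hnorm, Finset.mul_sum]
  refine Finset.sum_le_sum fun i _ => ?_
  rw [heig]
  rcases eq_or_ne i i₀ with rfl | hi
  · simp [hfi₀]
  · nlinarith [hi₀ i hi, mul_self_nonneg (c f i)]

/-- A spectral lower bound on vertex separators of regular graphs. -/
theorem algConn_separator_bound (G : SimpleGraph V) [Fintype V] [DecidableEq V]
    [DecidableRel G.Adj] [Nonempty V] {d : ℕ} (hreg : G.IsRegularOfDegree d)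
    (hpos : 0 < algConn G) {S A : Finset V} (hAS : A ⊆ Sᶜ)
    (hA : ∀ u ∈ A, ∀ w ∉ A, G.Adj u w → w ∈ S) :
    algConn G * ((Sᶜ.card : ℝ) - (2 * A.card - Sᶜ.card) ^ 2 / Fintype.card V) ≤
      d * S.card := by
  classical
  let g : V → ℝ := fun v => if v ∈ S then 0 else if v ∈ A then 1 else -1
  have hn : (0 : ℝ) < Fintype.card V := by exact_mod_cast Fintype.card_pos
  have hgsum : ∑ v, g v = 2 * A.card - Sᶜ.card := by
    have : ∀ v, g v = 2 * (if v ∈ A then 1 else 0) - if v ∈ Sᶜ then 1 else 0 := by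
      intro v
      by_cases hvS : v ∈ S
      · have : v ∉ A := fun h => Finset.mem_compl.1 (hAS h) hvS
        simp [g, hvS, this]
      · by_cases hvA : v ∈ A <;> simp [g, hvS, hvA]; norm_num
    simp only [this, Finset.sum_sub_distrib, ← Finset.mul_sum, Finset.sum_boole,
      Finset.filter_univ_mem]
  have hgsq : ∑ v, g v ^ 2 = Sᶜ.card := by
    have : ∀ v, g v ^ 2 = if v ∈ Sᶜ then 1 else 0 := by
      intro v
      by_cases hvS : v ∈ S
      · simp [g, hvS]
      · by_cases hvA : v ∈ A <;> simp [g, hvS, hvA]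
    simp only [this, Finset.sum_boole, Finset.filter_univ_mem]
  set m : ℝ := (2 * A.card - Sᶜ.card) / Fintype.card V with hm
  have hmn : m * Fintype.card V = 2 * A.card - Sᶜ.card := by
    rw [hm]; field_simp
  have hvar := algConn_mul_le G hpos (fun v => g v - m) (by
    rw [Finset.sum_sub_distrib, hgsum]
    simp only [Finset.sum_const, Finset.card_univ, nsmul_eq_mul]
    linarith)
  have hsq : ∑ v, (g v - m) ^ 2 =
      (Sᶜ.card : ℝ) - (2 * A.card - Sᶜ.card) ^ 2 / Fintype.card V := by
    have : ∀ v, (g v - m) ^ 2 = g v ^ 2 - 2 * m * g v + m ^ 2 := fun v => by ring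
    simp only [this, Finset.sum_add_distrib, Finset.sum_sub_distrib, ← Finset.mul_sum, hgsum,
      hgsq, Finset.sum_const, Finset.card_univ, nsmul_eq_mul]
    rw [hm]
    field_simp
    ring
  simp only [sub_sub_sub_cancel_right] at hvar
  have hterm : ∀ i j, (if G.Adj i j then (g i - g j) ^ 2 else 0) ≤
      (if G.Adj i j then (if i ∈ S then (1 : ℝ) else 0) else 0) +
        if G.Adj i j then (if j ∈ S then (1 : ℝ) else 0) else 0 := by
    intro i j
    by_cases hij : G.Adj i j
    · have h1 := fun h : i ∈ A => fun h' : j ∉ A => hA i h j h' hij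
      have h2 := fun h : j ∈ A => fun h' : i ∉ A => hA j h i h' hij.symm
      by_cases hi : i ∈ S <;> by_cases hj : j ∈ S <;> by_cases hi' : i ∈ A <;>
        by_cases hj' : j ∈ A <;> simp [g, hij, hi, hj, hi', hj'] at h1 h2 ⊢
    · simp [hij]
  have hdeg : ∀ i (r : ℝ), (∑ j, if G.Adj i j then r else 0) = d * r := by
    intro i r
    rw [← Finset.sum_filter, Finset.sum_const, nsmul_eq_mul, ← hreg i,
      ← G.card_neighborFinset_eq_degree, G.neighborFinset_eq_filter]
  have hfirst : (∑ i, ∑ j, if G.Adj i j then (if i ∈ S then (1 : ℝ) else 0) else 0) =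
      d * S.card := by
    simp only [hdeg, ← Finset.mul_sum]
    simp
  have hsecond : (∑ i, ∑ j, if G.Adj i j then (if j ∈ S then (1 : ℝ) else 0) else 0) =
      d * S.card := by
    rw [Finset.sum_comm, ← hfirst]
    simp only [G.adj_comm]
  have henergy := Finset.sum_le_sum fun i (_ : i ∈ Finset.univ) =>
    Finset.sum_le_sum fun j (_ : j ∈ Finset.univ) => hterm i j
  simp only [Finset.sum_add_distrib] at henergy
  rw [hfirst, hsecond] at henergy
  rw [hsq] at hvar
  linarith

theorem PosRank.card_le_degD {G : SimpleGraph V} [Fintype V] [DecidableEq V]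
    [DecidableRel G.Adj] [Nonempty V] (hreg : G.IsRegularOfDegree 3)
    (hlam : 3 - 2 * Real.sqrt 2 ≤ algConn G) {D : V → ℤ} (hD : PosRank G D) :
    (0.0486 : ℝ) * (Fintype.card V : ℝ) ≤ (degD D : ℝ) := by
  classical
  by_contra! hlt
  obtain ⟨E, hE, hDE, hhit⟩ := hD.exists_hitting
  rw [hDE.degD_eq] at hlt
  set S : Finset V := Finset.univ.filter fun v => 0 < E v with hS
  have hScard : (S.card : ℤ) ≤ degD E := by
    rw [hS, Finset.card_filter, degD]
    push_cast
    refine Finset.sum_le_sum fun v _ => ?_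
    have := hE v
    split_ifs <;> omega
  have hSlt : (S.card : ℝ) < 0.0486 * Fintype.card V :=
    lt_of_le_of_lt (by exact_mod_cast hScard) hlt
  have hS4 : 4 * S.card < Fintype.card V := by
    have : (4 * S.card : ℝ) < Fintype.card V := by
      have : (0 : ℝ) ≤ Fintype.card V := Nat.cast_nonneg _
      linarith
    exact_mod_cast this
  obtain ⟨A, hAS, hA, h1, h2⟩ := exists_balanced_split G (S := S)
    (fun B hB hcard => by simpa [hS] using hhit B hB hcard) hS4
  have hsqrt : Real.sqrt 2 < 1.4142136 := by
    rw [Real.sqrt_lt' (by norm_num)]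
    norm_num
  have hlam' : 0.1715728 ≤ algConn G := by linarith
  have hbound := algConn_separator_bound G hreg (by linarith) hAS hA
  have hn : (0 : ℝ) < Fintype.card V := by exact_mod_cast Fintype.card_pos
  have hcompl : (S.card : ℝ) + Sᶜ.card = Fintype.card V := by
    exact_mod_cast Finset.card_add_card_compl S
  have h1' : (Sᶜ.card : ℝ) ≤ 3 * A.card := by exact_mod_cast h1
  have h2' : 3 * (A.card : ℝ) ≤ 2 * Sᶜ.card := by exact_mod_cast h2
  generalize (Fintype.card V : ℝ) = n at *
  generalize (Sᶜ.card : ℝ) = w at *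
  generalize (A.card : ℝ) = a at *
  have hs0 : (0 : ℝ) ≤ S.card := Nat.cast_nonneg _
  generalize (S.card : ℝ) = s at *
  have hsq : (2 * a - w) ^ 2 ≤ w ^ 2 / 9 := by nlinarith
  have hgap : 0.9514 * (1 - 0.9514 / 9) * n ≤ w - (2 * a - w) ^ 2 / n := by
    rw [le_sub_iff_add_le, ← le_sub_iff_add_le', div_le_iff₀ hn]
    nlinarith [mul_nonneg (show 0 ≤ w - 0.9514 * n by linarith)
      (show 0 ≤ 9 * n - w - 0.9514 * n by linarith)]
  have := mul_le_mul hlam' hgap (by positivity) (by linarith)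
  push_cast at hbound
  linarith

/-- Corollary: if `G` is a 3-regular finite connected simple graph with algebraic
connectivity at least `3 − 2√2`, then `gon(G) ≥ 0.0486 |V(G)|`. -/
theorem gonality_ge_of_three_regular_spectral {V : Type*} [Fintype V] [DecidableEq V]
    (G : SimpleGraph V) [DecidableRel G.Adj] (hG : G.Connected)
    (hreg : G.IsRegularOfDegree 3)
    (hlam : 3 - 2 * Real.sqrt 2 ≤ algConn G) :
    (0.0486 : ℝ) * (Fintype.card V : ℝ) ≤ (gonality G : ℝ) := by
  have : Nonempty V := hG.nonempty
  have hone : PosRank G fun _ => 1 := fun v =>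
    ⟨fun w => 1 - if w = v then 1 else 0, fun w => by dsimp only; split_ifs <;> norm_num,
      0, by funext w; simp [lapply]⟩
  obtain ⟨D, hD, hdeg⟩ := Int.csInf_mem (s := {d : ℤ | ∃ D : V → ℤ, PosRank G D ∧ degD D = d})
    ⟨_, _, hone, rfl⟩ ⟨0, by
      rintro d ⟨D, hD, rfl⟩
      obtain ⟨E, hE, hDE, -⟩ := hD.exists_effective_pos (Classical.arbitrary V)
      rw [hDE.degD_eq]
      exact Finset.sum_nonneg fun v _ => hE v⟩
  rw [gonality, ← hdeg]
  exact hD.card_le_degD hreg hlam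

end GraphGonality
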